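/- There exists a measurable set E ⊂ [0,1] with 0 < |E| < 1 (Lebesgue measure) such that liminf_{ε→0⁺} (1/|log ε|) ‖γ_ε ∗ 1_E‖_{H^{1/2}}^2 = 0. -/

import Mathlib

open MeasureTheory Filter Topology Real
open scoped FourierTransform RealInnerProductSpace ENNReal

noncomputable section

variable {V : Type*} [NormedAddCommGroup V] [InnerProductSpace ℝ V]
  [FiniteDimensional ℝ V] [MeasurableSpace V] [BorelSpace V] [MeasureSpace V]

/-- convolution of two real-valued functions -/
def conv (f g : V → ℝ) (x : V) : ℝ := ∫ y, f y * g (x - y)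

/-- the standard Gaussian `γ(x) = (2π)^{-n/2} exp(-|x|²/2)` -/
def gauss (x : V) : ℝ :=
  (2 * π) ^ (-(Module.finrank ℝ V : ℝ) / 2) * Real.exp (-‖x‖ ^ 2 / 2)

/-- the scaled function `f_r(x) = r^{-n} f(x/r)` -/
def scaleFn (f : V → ℝ) (r : ℝ) (x : V) : ℝ := r⁻¹ ^ (Module.finrank ℝ V) * f (r⁻¹ • x)

/-- the scaled Gaussian `γ_ε` -/
def gaussSc (ε : ℝ) (x : V) : ℝ := scaleFn gauss ε x

/-- the squared `H^{1/2}` seminorm `∫ |ξ| |û(ξ)|² dξ` (extended-real valued) -/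
def H12e (u : V → ℝ) : ℝ≥0∞ :=
  ∫⁻ ξ, (‖ξ‖₊ : ℝ≥0∞) * (‖𝓕 (fun x => (u x : ℂ)) ξ‖₊ : ℝ≥0∞) ^ 2

/-- divergence of a vector field on ℝⁿ -/
def divg {n : ℕ} (φ : EuclideanSpace ℝ (Fin n) → EuclideanSpace ℝ (Fin n))
    (x : EuclideanSpace ℝ (Fin n)) : ℝ :=
  ∑ i, fderiv ℝ φ x (EuclideanSpace.single i 1) i

/-- perimeter of a set: `P(E) = sup { ∫_E div φ : φ ∈ C_c¹, ‖φ‖ ≤ 1 }` -/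
def perim {n : ℕ} (E : Set (EuclideanSpace ℝ (Fin n))) : ℝ≥0∞ :=
  ⨆ (φ : EuclideanSpace ℝ (Fin n) → EuclideanSpace ℝ (Fin n))
    (_ : ContDiff ℝ 1 φ) (_ : HasCompactSupport φ) (_ : ∀ x, ‖φ x‖ ≤ 1),
    ENNReal.ofReal (∫ x in E, divg φ x)

set_option linter.overlappingInstances false

/-- weighted energy -/
def JJ (ε : ℝ) (f : ℝ → ℂ) : ℝ≥0∞ :=
  ∫⁻ ξ : ℝ, ENNReal.ofReal (|ξ| * Real.exp (-(4 * π ^ 2 * ε ^ 2) * ξ ^ 2) * ‖𝓕 f ξ‖ ^ 2)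

/-- complex indicator -/
def chi (E : Set ℝ) : ℝ → ℂ := E.indicator fun _ => (1 : ℂ)

lemma chi_integrable {E : Set ℝ} (hE : MeasurableSet E) (hE1 : E ⊆ Set.Icc 0 1) :
    Integrable (chi E) := by
  have : volume E ≠ ∞ := ((measure_mono hE1).trans_lt (by simp)).ne
  exact (integrable_indicator_iff hE).2 (integrableOn_const this)

lemma gaussSc_eq (ε : ℝ) (hε : 0 < ε) :
    (fun x : ℝ => ((gaussSc ε x : ℝ) : ℂ)) = fun x : ℝ =>
      (((2 * π) ^ (-(1:ℝ) / 2) * ε⁻¹ : ℝ) : ℂ) *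
        Complex.exp (-π * ((2 * π * ε ^ 2)⁻¹ : ℝ) * x ^ 2) := by
  funext x
  simp only [gaussSc, scaleFn, gauss, Module.finrank_self]
  have : (Real.exp (-‖ε⁻¹ • x‖ ^ 2 / 2) : ℂ) =
      Complex.exp (-π * ((2 * π * ε ^ 2)⁻¹ : ℝ) * x ^ 2) := by
    rw [Complex.ofReal_exp]
    congr 1
    have : -‖ε⁻¹ • x‖ ^ 2 / 2 = -π * (2 * π * ε ^ 2)⁻¹ * x ^ 2 := by
      rw [Real.norm_eq_abs, sq_abs, smul_eq_mul]
      field_simp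
    rw [this]
    push_cast
    ring
  rw [← this]
  push_cast
  ring

lemma gaussSc_integrable (ε : ℝ) (hε : 0 < ε) :
    Integrable (fun x : ℝ => ((gaussSc ε x : ℝ) : ℂ)) := by
  rw [gaussSc_eq ε hε]
  apply Integrable.const_mul
  have := integrable_cexp_neg_mul_sq (b := π * ((2 * π * ε ^ 2)⁻¹ : ℝ)) (by
    rw [← Complex.ofReal_mul, Complex.ofReal_re]; positivity)
  refine this.congr (Eventually.of_forall fun x => ?_)
  simp only [neg_mul]

lemma gaussSc_fourier (ε : ℝ) (hε : 0 < ε) (ξ : ℝ) :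
    𝓕 (fun x : ℝ => ((gaussSc ε x : ℝ) : ℂ)) ξ =
      (Real.exp (-(2 * π ^ 2 * ε ^ 2) * ξ ^ 2) : ℂ) := by
  rw [gaussSc_eq ε hε]
  have hb : 0 < (((2 * π * ε ^ 2)⁻¹ : ℝ) : ℂ).re := by
    rw [Complex.ofReal_re]; positivity
  have h := congrFun (fourier_gaussian_pi hb) ξ
  have h2 : 𝓕 (fun x : ℝ => (((2 * π) ^ (-(1:ℝ) / 2) * ε⁻¹ : ℝ) : ℂ) *
        Complex.exp (-π * ((2 * π * ε ^ 2)⁻¹ : ℝ) * x ^ 2)) ξ =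
      (((2 * π) ^ (-(1:ℝ) / 2) * ε⁻¹ : ℝ) : ℂ) *
      𝓕 (fun x : ℝ => Complex.exp (-π * ((2 * π * ε ^ 2)⁻¹ : ℝ) * x ^ 2)) ξ := by
    simp only [Real.fourier_real_eq, Circle.smul_def, smul_eq_mul]
    rw [← integral_const_mul]
    congr 1
    funext x
    ring
  rw [h2, h]
  have h3 : (((2 * π * ε ^ 2)⁻¹ : ℝ) : ℂ) ^ (1 / 2 : ℂ) =
      (((2 * π * ε ^ 2)⁻¹ ^ (1 / 2 : ℝ) : ℝ) : ℂ) := by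
    rw [Complex.ofReal_cpow (by positivity)]
    norm_num
  have h4 : ((2 * π * ε ^ 2)⁻¹ : ℝ) ^ (1 / 2 : ℝ) = (2 * π) ^ (-(1:ℝ) / 2) * ε⁻¹ := by
    rw [mul_inv, Real.mul_rpow (by positivity) (by positivity), Real.inv_rpow (by positivity),
      ← Real.rpow_neg (by positivity), ← inv_pow, ← Real.sqrt_eq_rpow (ε⁻¹ ^ 2),
      Real.sqrt_sq (by positivity)]
    norm_num
  rw [h3, h4]
  have h5 : (((2 * π) ^ (-(1:ℝ) / 2) * ε⁻¹ : ℝ) : ℂ) ≠ 0 := by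
    have : (0:ℝ) < (2 * π) ^ (-(1:ℝ) / 2) * ε⁻¹ := by positivity
    exact_mod_cast this.ne'
  rw [one_div, ← mul_assoc, mul_inv_cancel₀ h5, one_mul, Complex.ofReal_exp]
  congr 1
  push_cast
  have : (π : ℂ) ≠ 0 := by exact_mod_cast Real.pi_ne_zero
  field_simp

lemma H12e_eq (ε : ℝ) (hε : 0 < ε) {E : Set ℝ} (hE : MeasurableSet E)
    (hE1 : E ⊆ Set.Icc 0 1) :
    H12e (conv (gaussSc ε) (E.indicator fun _ => (1 : ℝ))) = JJ ε (chi E) := by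
  unfold H12e JJ
  congr 1
  funext ξ
  have h1 : (fun x : ℝ => ((conv (gaussSc ε) (E.indicator fun _ => (1 : ℝ)) x : ℝ) : ℂ)) =
      convolution (fun x : ℝ => ((gaussSc ε x : ℝ) : ℂ)) (chi E)
        (ContinuousLinearMap.mul ℂ ℂ) volume := by
    funext x
    rw [convolution_def]
    unfold conv
    rw [← integral_complex_ofReal]
    congr 1
    funext y
    simp only [chi, ContinuousLinearMap.mul_apply', Complex.ofReal_mul, Set.indicator]
    split_ifs <;> simp
  rw [h1, Real.fourier_mul_convolution_eq (gaussSc_integrable ε hε) (chi_integrable hE hE1),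
    gaussSc_fourier ε hε]
  have h2 : (‖ξ‖₊ : ℝ≥0∞) = ENNReal.ofReal |ξ| := by
    rw [← Real.norm_eq_abs, ofReal_norm_eq_enorm]; rfl
  have h3 : ∀ z : ℂ, (‖z‖₊ : ℝ≥0∞) = ENNReal.ofReal ‖z‖ := by
    intro z
    rw [ofReal_norm_eq_enorm]; rfl
  rw [h2, h3, ← ENNReal.ofReal_pow (norm_nonneg _), ← ENNReal.ofReal_mul (abs_nonneg _)]
  congr 1
  rw [norm_mul, mul_pow, ← mul_assoc]
  congr 2
  rw [Complex.norm_real, Real.norm_eq_abs, abs_of_pos (Real.exp_pos _), ← Real.exp_nat_mul]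
  congr 1
  push_cast
  ring

lemma JJ_le (ε : ℝ) (f g : ℝ → ℂ) (B : ℝ → ℝ) (hB : Measurable B)
    (h : ∀ ξ, ‖𝓕 f ξ - 𝓕 g ξ‖ ≤ B ξ) :
    JJ ε f ≤ 2 * JJ ε g + 2 * ∫⁻ ξ : ℝ,
      ENNReal.ofReal (|ξ| * Real.exp (-(4 * π ^ 2 * ε ^ 2) * ξ ^ 2) * B ξ ^ 2) := by
  unfold JJ
  rw [← lintegral_const_mul' _ _ (by simp), ← lintegral_const_mul' _ _ (by simp),
    ← lintegral_add_right _ (by fun_prop)]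
  apply lintegral_mono
  intro ξ
  have h2 : (2 : ℝ≥0∞) = ENNReal.ofReal 2 := by simp
  have hw : 0 ≤ |ξ| * Real.exp (-(4 * π ^ 2 * ε ^ 2) * ξ ^ 2) := by positivity
  simp only
  rw [h2, ← ENNReal.ofReal_mul (by norm_num), ← ENNReal.ofReal_mul (by norm_num),
    ← ENNReal.ofReal_add (by positivity) (by positivity)]
  apply ENNReal.ofReal_le_ofReal
  have h3 : ‖𝓕 f ξ‖ ≤ ‖𝓕 g ξ‖ + B ξ := by
    have := norm_add_le (𝓕 g ξ) (𝓕 f ξ - 𝓕 g ξ)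
    rw [add_sub_cancel] at this
    linarith [h ξ]
  have h4 : ‖𝓕 f ξ‖ ^ 2 ≤ 2 * ‖𝓕 g ξ‖ ^ 2 + 2 * B ξ ^ 2 := by
    have := pow_le_pow_left₀ (norm_nonneg _) h3 2
    nlinarith [sq_nonneg (‖𝓕 g ξ‖ - B ξ)]
  nlinarith [mul_le_mul_of_nonneg_left h4 hw]

lemma weight_fin (ε : ℝ) (hε : 0 < ε) (k : ℕ) :
    ∫⁻ ξ : ℝ, ENNReal.ofReal (|ξ| * Real.exp (-(4 * π ^ 2 * ε ^ 2) * ξ ^ 2) * |ξ| ^ k) < ∞ := by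
  have h := integrable_rpow_mul_exp_neg_mul_sq (b := 4 * π ^ 2 * ε ^ 2) (by positivity)
    (s := ((k + 1 : ℕ) : ℝ)) (by have : (0:ℝ) ≤ ((k+1 : ℕ) : ℝ) := Nat.cast_nonneg _
                                 linarith)
  have h2 := h.norm.lintegral_lt_top
  refine lt_of_le_of_lt (lintegral_mono fun ξ => ?_) h2
  apply ENNReal.ofReal_le_ofReal
  rw [Real.rpow_natCast, norm_mul, norm_pow, Real.norm_eq_abs, Real.norm_eq_abs,
    abs_of_pos (Real.exp_pos _), pow_succ]
  apply le_of_eq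
  ring

/-- stability of the energy -/
lemma JJ_stable (ε : ℝ) (hε : 0 < ε) : ∃ C : ℝ≥0∞, C ≠ ∞ ∧ ∀ E F : Set ℝ,
    MeasurableSet E → MeasurableSet F → E ⊆ Set.Icc 0 1 → F ⊆ Set.Icc 0 1 →
    JJ ε (chi F) ≤ 2 * JJ ε (chi E) + C * (volume (symmDiff E F)) ^ 2 := by
  refine ⟨2 * ∫⁻ ξ : ℝ, ENNReal.ofReal (|ξ| * Real.exp (-(4 * π ^ 2 * ε ^ 2) * ξ ^ 2) * |ξ| ^ 0),
    ENNReal.mul_ne_top (by simp) (weight_fin ε hε 0).ne, ?_⟩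
  intro E F hE hF hE1 hF1
  have hfin : volume (symmDiff E F) ≠ ∞ := by
    refine ((measure_mono (?_ : symmDiff E F ⊆ Set.Icc 0 1)).trans_lt (by simp)).ne
    intro x hx
    rcases hx with hx | hx
    · exact hE1 hx.1
    · exact hF1 hx.1
  have key : ∀ ξ, ‖𝓕 (chi F) ξ - 𝓕 (chi E) ξ‖ ≤ (volume (symmDiff E F)).toReal := by
    intro ξ
    rw [Real.fourier_real_eq, Real.fourier_real_eq, ← integral_sub]
    · calc _ ≤ ∫ x, (symmDiff E F).indicator (fun _ => (1:ℝ)) x := by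
            apply norm_integral_le_of_norm_le
            · exact (integrable_indicator_iff (hE.symmDiff hF)).2 (integrableOn_const hfin)
            · refine Eventually.of_forall fun x => ?_
              rw [← smul_sub, Circle.norm_smul]
              by_cases h1 : x ∈ E <;> by_cases h2 : x ∈ F <;>
                simp [chi, h1, h2, Set.mem_symmDiff]
        _ = _ := by
            exact integral_indicator_one (hE.symmDiff hF)
    · simpa [mul_comm] using (Real.fourierIntegral_convergent_iff ξ).2 (chi_integrable hF hF1)
    · simpa [mul_comm] using (Real.fourierIntegral_convergent_iff ξ).2 (chi_integrable hE hE1)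
  refine (JJ_le ε _ _ _ measurable_const key).trans ?_
  refine add_le_add le_rfl ?_
  rw [mul_assoc (2 : ℝ≥0∞)]
  refine mul_le_mul' le_rfl ?_
  have : ∀ ξ : ℝ, ENNReal.ofReal (|ξ| * Real.exp (-(4 * π ^ 2 * ε ^ 2) * ξ ^ 2) *
      (volume (symmDiff E F)).toReal ^ 2) =
      ENNReal.ofReal (|ξ| * Real.exp (-(4 * π ^ 2 * ε ^ 2) * ξ ^ 2) * |ξ| ^ 0) *
        volume (symmDiff E F) ^ 2 := by
    intro ξ
    rw [ENNReal.ofReal_mul (by positivity), ENNReal.ofReal_pow (by positivity),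
      ENNReal.ofReal_toReal hfin, pow_zero, mul_one]
  simp_rw [this]
  rw [lintegral_mul_const' _ _ (by finiteness)]

lemma ind_ii {S : Set ℝ} (hS : MeasurableSet S) (a b : ℝ) :
    IntervalIntegrable (S.indicator fun _ => (1:ℝ)) volume a b := by
  rw [intervalIntegrable_iff]
  exact IntegrableOn.indicator (integrableOn_const (by simp)) hS

lemma cell_exists {K U : Set ℝ} (hK : MeasurableSet K) (hU : MeasurableSet U) (hKU : K ⊆ U)
    {g : ℝ → ℝ} (hg : Continuous g) (g0 : ∀ x, 0 ≤ g x) (g1 : ∀ x, g x ≤ 1)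
    (gK : ∀ x ∈ K, g x = 1) (gU : ∀ x, x ∉ U → g x = 0) {a b : ℝ} (hab : a ≤ b) :
    ∃ c, ∫ x in a..b, ((K ∪ (U ∩ Set.Iic c)).indicator (fun _ => (1:ℝ)) x - g x) = 0 := by
  set χ : ℝ → ℝ := (U \ K).indicator fun _ => (1:ℝ) with hχ
  set κ : ℝ → ℝ := K.indicator fun _ => (1:ℝ) with hκ
  have iχ := ind_ii (hU.diff hK)
  have iκ := ind_ii hK
  have ig : ∀ a b, IntervalIntegrable g volume a b := fun a b => hg.intervalIntegrable a b
  have hP : Continuous fun c => ∫ x in a..c, χ x := intervalIntegral.continuous_primitive iχ a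
  have hv : (∫ x in a..b, (g x - κ x)) ∈ Set.Icc (∫ x in a..a, χ x) (∫ x in a..b, χ x) := by
    constructor
    · rw [intervalIntegral.integral_same]
      apply intervalIntegral.integral_nonneg hab
      intro x _
      by_cases hx : x ∈ K
      · simp [hκ, hx, gK x hx]
      · simp [hκ, hx, g0 x]
    · apply intervalIntegral.integral_mono hab ((ig a b).sub (iκ a b)) (iχ a b)
      intro x
      by_cases hx : x ∈ K
      · simp [hκ, hχ, hx, gK x hx]
      · by_cases hx' : x ∈ U
        · simp [hκ, hχ, hx, hx', g1 x]
        · simp [hκ, hχ, hx, hx', gU x hx']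
  obtain ⟨c, hc, hcv⟩ := intermediate_value_Icc hab hP.continuousOn hv
  simp only at hcv
  refine ⟨c, ?_⟩
  set F := K ∪ (U ∩ Set.Iic c) with hF
  have hFm : MeasurableSet F := hK.union (hU.inter measurableSet_Iic)
  have iF := ind_ii hFm
  rw [← intervalIntegral.integral_add_adjacent_intervals ((iF a c).sub (ig a c))
    ((iF c b).sub (ig c b))]
  have e1 : ∫ x in a..c, (F.indicator (fun _ => (1:ℝ)) x - g x) =
      ∫ x in a..c, (χ x - (g x - κ x)) := by
    apply intervalIntegral.integral_congr
    intro x hx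
    rw [Set.uIcc_of_le hc.1] at hx
    have hxc : x ≤ c := hx.2
    by_cases h1 : x ∈ K
    · simp [hκ, hχ, hF, h1]
    · by_cases h2 : x ∈ U <;> simp [hκ, hχ, hF, h1, h2, hxc]
  have e2 : ∫ x in c..b, (F.indicator (fun _ => (1:ℝ)) x - g x) =
      ∫ x in c..b, (- (g x - κ x)) := by
    apply intervalIntegral.integral_congr_ae
    refine Eventually.of_forall fun x hx => ?_
    rw [Set.uIoc_of_le hc.2] at hx
    have hxc : ¬ x ≤ c := not_le.2 hx.1
    by_cases h1 : x ∈ K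
    · simp [hκ, hF, h1]
    · simp [hκ, hF, h1, hxc]
  rw [e1, e2, intervalIntegral.integral_sub (iχ a c) ((ig a c).sub (iκ a c)),
    intervalIntegral.integral_neg, hcv,
    ← intervalIntegral.integral_add_adjacent_intervals ((ig a c).sub (iκ a c))
    ((ig c b).sub (iκ c b))]
  ring

lemma char_lip (ξ x y : ℝ) :
    ‖(𝐞 (-(x * ξ)) : ℂ) - (𝐞 (-(y * ξ)) : ℂ)‖ ≤ 2 * π * |ξ| * |x - y| := by
  have h : (𝐞 (-(x * ξ)) : ℂ) - (𝐞 (-(y * ξ)) : ℂ) =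
      (𝐞 (-(y * ξ)) : ℂ) * (Complex.exp (Complex.I * ((2 * π * (-(x - y) * ξ) : ℝ) : ℂ)) - 1) := by
    rw [mul_sub, mul_one]
    congr 1
    rw [Real.fourierChar_apply, Real.fourierChar_apply, ← Complex.exp_add]
    congr 1
    push_cast
    ring
  rw [h, norm_mul, Circle.norm_coe, one_mul]
  refine Real.norm_exp_I_mul_ofReal_sub_one_le.trans (le_of_eq ?_)
  rw [Real.norm_eq_abs, abs_mul, abs_mul, abs_mul, abs_neg, abs_of_pos Real.pi_pos]
  norm_num
  ring

lemma approx_exists {K U : Set ℝ} (hK : MeasurableSet K) (hU : MeasurableSet U) (hKU : K ⊆ U)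
    (hU1 : U ⊆ Set.Ioo 0 1)
    {g : ℝ → ℝ} (hg : Continuous g) (g0 : ∀ x, 0 ≤ g x) (g1 : ∀ x, g x ≤ 1)
    (gK : ∀ x ∈ K, g x = 1) (gU : ∀ x, x ∉ U → g x = 0) (m : ℕ) (hm : 0 < m) :
    ∃ F, MeasurableSet F ∧ K ⊆ F ∧ F ⊆ U ∧ ∀ ξ : ℝ,
      ‖𝓕 (chi F) ξ - 𝓕 (fun x => (g x : ℂ)) ξ‖ ≤ 2 * π / m * |ξ| := by
  have hm' : (0:ℝ) < m := by exact_mod_cast hm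
  have hcell : ∀ j : ℤ, ((j:ℝ) / m) ≤ ((j:ℝ) + 1) / m := fun j => by gcongr; linarith
  choose c hc using fun j : ℤ => cell_exists hK hU hKU hg g0 g1 gK gU (hcell j)
  set F : Set ℝ := K ∪ (U ∩ {x | x ≤ c ⌊(m:ℝ) * x⌋}) with hF
  have hFm : MeasurableSet F := by
    refine hK.union (hU.inter (measurableSet_le measurable_id ?_))
    exact (measurable_from_top (f := c)).comp (Int.measurable_floor.comp (measurable_const_mul _))
  have hFU : F ⊆ U := Set.union_subset hKU Set.inter_subset_left
  refine ⟨F, hFm, Set.subset_union_left, hFU, ?_⟩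
  intro ξ
  set d : ℝ → ℝ := fun x => F.indicator (fun _ => (1:ℝ)) x - g x with hd
  have d1 : ∀ x, |d x| ≤ 1 := by
    intro x
    rw [abs_le]
    by_cases hx : x ∈ F
    · simp only [hd, hx, Set.indicator_of_mem]; constructor <;> linarith [g0 x, g1 x]
    · simp only [hd, hx, not_false_eq_true, Set.indicator_of_notMem]
      constructor <;> linarith [g0 x, g1 x]
  have dU : ∀ x, x ∉ U → d x = 0 := by
    intro x hx
    have : x ∉ F := fun h => hx (hFU h)
    simp [hd, this, gU x hx]
  have dm : Measurable d := (measurable_const.indicator hFm).sub hg.measurable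
  have hF1 : F ⊆ Set.Icc 0 1 := (hFU.trans hU1).trans Set.Ioo_subset_Icc_self
  have gint : Integrable (fun x => (g x : ℂ)) := by
    apply Continuous.integrable_of_hasCompactSupport (by fun_prop)
    apply HasCompactSupport.intro (isCompact_Icc (a := (0:ℝ)) (b := 1))
    intro x hx
    have : x ∉ U := fun h => hx (Set.Ioo_subset_Icc_self (hU1 h))
    simp [gU x this]
  -- the integrand
  set φ : ℝ → ℂ := fun x => (𝐞 (-(x * ξ)) : ℂ) * (d x : ℂ) with hφ
  have φm : Measurable φ := by
    have : Continuous fun x : ℝ => (𝐞 (-(x * ξ)) : ℂ) := by fun_prop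
    exact this.measurable.mul (Complex.measurable_ofReal.comp dm)
  have φ1 : ∀ x, ‖φ x‖ ≤ 1 := by
    intro x
    simp only [hφ, norm_mul, Circle.norm_coe, one_mul, Complex.norm_real, Real.norm_eq_abs]
    exact d1 x
  have iφ : ∀ a b, IntervalIntegrable φ volume a b := by
    intro a b
    refine (intervalIntegrable_const (c := (1:ℝ))).mono_fun φm.aestronglyMeasurable ?_
    exact Eventually.of_forall fun x => by simpa using φ1 x
  have idd : ∀ a b, IntervalIntegrable (fun x => (d x : ℂ)) volume a b := by
    intro a b
    refine (intervalIntegrable_const (c := (1:ℝ))).mono_fun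
      (Complex.measurable_ofReal.comp dm).aestronglyMeasurable ?_
    exact Eventually.of_forall fun x => by simpa using d1 x
  have step1 : 𝓕 (chi F) ξ - 𝓕 (fun x => (g x : ℂ)) ξ = ∫ x in (0:ℝ)..1, φ x := by
    rw [Real.fourier_real_eq, Real.fourier_real_eq, ← integral_sub]
    · rw [intervalIntegral.integral_of_le zero_le_one, ← integral_indicator measurableSet_Ioc]
      congr 1
      funext x
      by_cases hx : x ∈ Set.Ioc (0:ℝ) 1
      · rw [Set.indicator_of_mem hx, ← smul_sub, Circle.smul_def, smul_eq_mul]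
        simp only [hφ, hd, chi]
        by_cases h1 : x ∈ F <;> simp [h1]
      · rw [Set.indicator_of_notMem hx]
        have h1 : x ∉ U := fun h => hx (Set.Ioo_subset_Ioc_self (hU1 h))
        have h2 : x ∉ F := fun h => h1 (hFU h)
        simp [chi, h2, gU x h1]
    · simpa [mul_comm] using (Real.fourierIntegral_convergent_iff ξ).2 (chi_integrable hFm hF1)
    · simpa [mul_comm] using (Real.fourierIntegral_convergent_iff ξ).2 gint
  have step2 : ∑ k ∈ Finset.range m, ∫ x in (((k : ℕ) : ℝ) / m)..(((k + 1 : ℕ) : ℝ) / m), φ x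
      = ∫ x in (0:ℝ)..1, φ x := by
    have := intervalIntegral.sum_integral_adjacent_intervals (f := φ) (μ := volume)
      (a := fun k : ℕ => (k : ℝ) / m) (n := m) (fun k _ => iφ _ _)
    rw [this]
    simp [hm'.ne']
  have step3 : ∀ k : ℕ, ‖∫ x in (((k : ℕ) : ℝ) / m)..(((k + 1 : ℕ) : ℝ) / m), φ x‖ ≤
      2 * π * |ξ| * (1 / m) * (1 / m) := by
    intro k
    set a : ℝ := (k : ℝ) / m with ha
    set b : ℝ := ((k + 1 : ℕ) : ℝ) / m with hb
    have hba : b - a = 1 / m := by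
      rw [ha, hb]; push_cast; ring
    have hab : a ≤ b := by
      have : (0:ℝ) < 1 / m := by positivity
      linarith
    have hz : ∫ x in a..b, d x = 0 := by
      have h0 := hc (k : ℤ)
      have e : ((k : ℤ) : ℝ) / m = a := by rw [ha]; push_cast; rfl
      have e' : (((k : ℤ) : ℝ) + 1) / m = b := by rw [hb]; push_cast; rfl
      rw [e, e'] at h0
      rw [← h0]
      apply intervalIntegral.integral_congr_ae
      have hne : ∀ᵐ x : ℝ, x ≠ b := by
        simp [ae_iff]
      filter_upwards [hne] with x hxb hx
      rw [Set.uIoc_of_le hab] at hx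
      have hfl : ⌊(m:ℝ) * x⌋ = (k : ℤ) := by
        rw [Int.floor_eq_iff]
        have h1 := hx.1
        have h2 := lt_of_le_of_ne hx.2 hxb
        rw [ha, div_lt_iff₀ hm'] at h1
        rw [hb, lt_div_iff₀ hm'] at h2
        push_cast at h1 h2 ⊢
        constructor <;> linarith
      simp only [hd]
      congr 1
      by_cases h1 : x ∈ K
      · simp [hF, h1]
      · by_cases h2 : x ∈ U <;> by_cases h3 : x ≤ c (k : ℤ) <;> simp [hF, h1, h2, h3, hfl]
    have hz' : ∫ x in a..b, (d x : ℂ) = 0 := by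
      rw [intervalIntegral.integral_ofReal, hz]; simp
    have e : ∫ x in a..b, φ x =
        ∫ x in a..b, ((𝐞 (-(x * ξ)) : ℂ) - (𝐞 (-(a * ξ)) : ℂ)) * (d x : ℂ) := by
      have : ∫ x in a..b, (𝐞 (-(a * ξ)) : ℂ) * (d x : ℂ) = 0 := by
        rw [intervalIntegral.integral_const_mul, hz', mul_zero]
      simp_rw [sub_mul]
      rw [intervalIntegral.integral_sub (iφ a b) ((idd a b).const_mul _), this, sub_zero]
    rw [e]
    have := intervalIntegral.norm_integral_le_of_norm_le_const (a := a) (b := b)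
      (f := fun x => ((𝐞 (-(x * ξ)) : ℂ) - (𝐞 (-(a * ξ)) : ℂ)) * (d x : ℂ))
      (C := 2 * π * |ξ| * (1 / m)) (by
        intro x hx
        rw [Set.uIoc_of_le hab] at hx
        rw [norm_mul, Complex.norm_real, Real.norm_eq_abs]
        have h1 := char_lip ξ x a
        have h2 : |x - a| ≤ 1 / m := by
          rw [abs_of_nonneg (by linarith [hx.1])]; linarith [hx.2]
        calc _ ≤ (2 * π * |ξ| * |x - a|) * 1 :=
              mul_le_mul h1 (d1 x) (abs_nonneg _) (by positivity)
          _ ≤ _ := by rw [mul_one]; gcongr)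
    rw [hba, abs_of_pos (by positivity : (0:ℝ) < 1 / m)] at this
    exact this
  rw [step1, ← step2]
  refine (norm_sum_le _ _).trans ((Finset.sum_le_sum fun k _ => step3 k).trans ?_)
  rw [Finset.sum_const, Finset.card_range, nsmul_eq_mul]
  apply le_of_eq
  field_simp

lemma smooth_energy {g : ℝ → ℝ} (hg : ContDiff ℝ ((⊤ : ℕ∞) : WithTop ℕ∞) g)
    (hs : HasCompactSupport g) :
    ∃ C : ℝ≥0∞, C ≠ ∞ ∧ ∀ ε, JJ ε (fun x => (g x : ℂ)) ≤ C := by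
  have hgc : ContDiff ℝ ((⊤ : ℕ∞) : WithTop ℕ∞) (fun x => (g x : ℂ)) :=
    Complex.ofRealCLM.contDiff.comp hg
  have hsc : HasCompactSupport (fun x => (g x : ℂ)) := hs.comp_left (g := Complex.ofReal) (by simp)
  set G : SchwartzMap ℝ ℂ := hsc.toSchwartzMap hgc with hG
  have hGc : (⇑G : ℝ → ℂ) = fun x => (g x : ℂ) := by
    funext x; simp [hG]
  have hF : ∀ ξ, (𝓕 G) ξ = 𝓕 (fun x => (g x : ℂ)) ξ := by
    intro ξ
    rw [SchwartzMap.fourier_coe, hGc]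
  have hint := (SchwartzMap.integrable_pow_mul volume (𝓕 G) 1).const_mul (∫ x, ‖(g x : ℂ)‖)
  refine ⟨_, hint.lintegral_lt_top.ne, ?_⟩
  intro ε
  unfold JJ
  apply lintegral_mono
  intro ξ
  apply ENNReal.ofReal_le_ofReal
  rw [hF, pow_one, Real.norm_eq_abs]
  have h1 : ‖𝓕 (fun x => (g x : ℂ)) ξ‖ ≤ ∫ x, ‖(g x : ℂ)‖ := by
    rw [Real.fourier_real_eq]
    refine (norm_integral_le_integral_norm _).trans (le_of_eq ?_)
    simp [Circle.norm_smul]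
  have h2 : Real.exp (-(4 * π ^ 2 * ε ^ 2) * ξ ^ 2) ≤ 1 := by
    rw [Real.exp_le_one_iff]
    have : 0 ≤ (4 * π ^ 2 * ε ^ 2) * ξ ^ 2 := by positivity
    linarith
  calc _ ≤ |ξ| * 1 * (‖𝓕 (fun x => (g x : ℂ)) ξ‖ * ‖𝓕 (fun x => (g x : ℂ)) ξ‖) := by
        rw [← sq]; gcongr
    _ ≤ |ξ| * 1 * ((∫ x, ‖(g x : ℂ)‖) * ‖𝓕 (fun x => (g x : ℂ)) ξ‖) := by gcongr
    _ = _ := by ring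

lemma dense_step {E : Set ℝ} (hE : MeasurableSet E) (hE1 : E ⊆ Set.Icc 0 1) {η : ℝ≥0∞}
    (hη : 0 < η) (n : ℕ) : ∃ ε : ℝ, 0 < ε ∧ ε < 1 / (n + 1) ∧ ∃ F, MeasurableSet F ∧
      F ⊆ Set.Icc 0 1 ∧ volume (symmDiff E F) ≤ η ∧
      ENNReal.ofReal |Real.log ε|⁻¹ * JJ ε (chi F) ≤ ENNReal.ofReal (1 / (n + 1)) := by
  set E' := E ∩ Set.Ioo 0 1 with hE'
  have mE' : MeasurableSet E' := hE.inter measurableSet_Ioo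
  have fE' : volume E' ≠ ∞ :=
    ((measure_mono Set.inter_subset_right).trans_lt (by simp : volume (Set.Ioo (0:ℝ) 1) < ∞)).ne
  have hη2 : η / 2 ≠ 0 := (ENNReal.half_pos hη.ne').ne'
  obtain ⟨K, hKE, hKc, hKv⟩ := mE'.exists_isCompact_sdiff_lt fE' hη2
  obtain ⟨U', hUE, hUo, -, hUv⟩ := mE'.exists_isOpen_sdiff_lt fE' hη2
  set U := U' ∩ Set.Ioo 0 1 with hU
  have oU : IsOpen U := hUo.inter isOpen_Ioo
  have hKU : K ⊆ U := fun x hx => ⟨hUE (hKE hx), (hKE hx).2⟩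
  obtain ⟨g, gs, gr, gsupp, gone⟩ := exists_contMDiff_support_eq_eq_one_iff
    (modelWithCornersSelf ℝ ℝ) (n := ⊤) oU hKc.isClosed hKU
  have gsm : ContDiff ℝ ((⊤ : ℕ∞) : WithTop ℕ∞) g := gs.contDiff
  have g01 : ∀ x, g x ∈ Set.Icc (0:ℝ) 1 := fun x => gr ⟨x, rfl⟩
  have gU : ∀ x, x ∉ U → g x = 0 := by
    intro x hx
    rw [← gsupp] at hx
    simpa using hx
  have gc : HasCompactSupport g := by
    apply HasCompactSupport.intro (isCompact_Icc (a := (0:ℝ)) (b := 1))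
    intro x hx
    exact gU x fun h => hx (Set.Ioo_subset_Icc_self h.2)
  obtain ⟨C, hC, hCJ⟩ := smooth_energy gsm gc
  have hn : (0:ℝ) < n + 1 := by positivity
  set T : ℝ := (2 * C + 1).toReal with hT
  have hTn : 2 * C + 1 ≠ ∞ := by finiteness
  have hT0 : 0 ≤ T := ENNReal.toReal_nonneg
  set M : ℝ := (n + 1) * (T + 1) with hM
  have hM0 : 0 < M := by positivity
  set ε : ℝ := Real.exp (-M) with hε
  have hε0 : 0 < ε := Real.exp_pos _
  set W := ∫⁻ ξ : ℝ, ENNReal.ofReal (|ξ| * Real.exp (-(4 * π ^ 2 * ε ^ 2) * ξ ^ 2) * |ξ| ^ 2)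
    with hW
  have hWf : W ≠ ∞ := (weight_fin ε hε0 2).ne
  obtain ⟨m, hm⟩ := exists_nat_ge (8 * π ^ 2 * W.toReal + 1)
  have hm1 : (1:ℝ) ≤ m := by
    have : 0 ≤ 8 * π ^ 2 * W.toReal := by positivity
    linarith
  have hmp : 0 < m := by exact_mod_cast (lt_of_lt_of_le one_pos hm1)
  obtain ⟨F, mF, hKF, hFU, hFf⟩ := approx_exists hKc.measurableSet oU.measurableSet hKU
    Set.inter_subset_right gsm.continuous (fun x => (g01 x).1) (fun x => (g01 x).2)
    (fun x hx => (gone x).1 hx) gU m hmp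
  refine ⟨ε, hε0, ?_, F, mF, fun x hx => Set.Ioo_subset_Icc_self (hFU hx).2, ?_, ?_⟩
  · rw [hε, Real.exp_neg, ← one_div]
    apply one_div_lt_one_div_of_lt hn
    have h1 := Real.add_one_le_exp M
    have : (n:ℝ) + 1 ≤ M := by rw [hM]; nlinarith
    linarith
  · have hsub : symmDiff E F ⊆ (E' \ K) ∪ (U' \ E') ∪ {0, 1} := by
      intro x hx
      by_cases h0 : x = 0
      · right; simp [h0]
      by_cases h1 : x = 1
      · right; simp [h1]
      left
      rcases hx with ⟨hx, hx'⟩ | ⟨hx, hx'⟩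
      · left
        have := hE1 hx
        refine ⟨⟨hx, lt_of_le_of_ne this.1 (Ne.symm h0), lt_of_le_of_ne this.2 h1⟩, ?_⟩
        exact fun h => hx' (hKF h)
      · right
        exact ⟨(hFU hx).1, fun h => hx' h.1⟩
    have hz : volume ({0, 1} : Set ℝ) = 0 := (Set.toFinite _).measure_zero _
    calc volume (symmDiff E F) ≤ volume ((E' \ K) ∪ (U' \ E') ∪ {0, 1}) := measure_mono hsub
      _ ≤ volume (E' \ K) + volume (U' \ E') + volume ({0, 1} : Set ℝ) :=
          (measure_union_le _ _).trans (add_le_add (measure_union_le _ _) le_rfl)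
      _ ≤ η / 2 + η / 2 + 0 := by
          rw [hz]; exact add_le_add (add_le_add hKv.le hUv.le) le_rfl
      _ = η := by rw [add_zero, ENNReal.add_halves]
  · have hlog : |Real.log ε|⁻¹ = M⁻¹ := by
      rw [hε, Real.log_exp, abs_neg, abs_of_pos hM0]
    have hJ : JJ ε (chi F) ≤ 2 * C + 1 := by
      refine (JJ_le ε _ _ (fun ξ => 2 * π / m * |ξ|) (by fun_prop) hFf).trans ?_
      refine add_le_add (mul_le_mul' le_rfl (hCJ ε)) ?_
      have e : ∀ ξ : ℝ, ENNReal.ofReal (|ξ| * Real.exp (-(4 * π ^ 2 * ε ^ 2) * ξ ^ 2) *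
          (2 * π / m * |ξ|) ^ 2) = ENNReal.ofReal ((2 * π / m) ^ 2) *
          ENNReal.ofReal (|ξ| * Real.exp (-(4 * π ^ 2 * ε ^ 2) * ξ ^ 2) * |ξ| ^ 2) := by
        intro ξ
        rw [← ENNReal.ofReal_mul (by positivity)]
        congr 1
        ring
      simp_rw [e]
      rw [lintegral_const_mul' _ _ (by simp), ← hW, ← ENNReal.ofReal_toReal hWf]
      have h2 : (2 : ℝ≥0∞) = ENNReal.ofReal 2 := by simp
      rw [h2, ← ENNReal.ofReal_mul (by positivity), ← ENNReal.ofReal_mul (by positivity),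
        ENNReal.ofReal_le_one]
      have h3 : 2 * ((2 * π / m) ^ 2 * W.toReal) = 8 * π ^ 2 * W.toReal / (m:ℝ) ^ 2 := by
        field_simp
        ring
      rw [h3, div_le_one (by positivity)]
      nlinarith
    rw [hlog]
    calc _ ≤ ENNReal.ofReal M⁻¹ * (2 * C + 1) := mul_le_mul' le_rfl hJ
      _ = ENNReal.ofReal (M⁻¹ * T) := by
          rw [ENNReal.ofReal_mul (by positivity), hT, ENNReal.ofReal_toReal hTn]
      _ ≤ _ := by
          apply ENNReal.ofReal_le_ofReal
          rw [hM, inv_mul_eq_div, div_le_div_iff₀ (by positivity) hn]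
          nlinarith

/-- measurable subsets of the unit interval -/
def Good (E : Set ℝ) : Prop := MeasurableSet E ∧ E ⊆ Set.Icc 0 1

lemma full_step (n : ℕ) {E : Set ℝ} (hE : Good E) {r : ℝ≥0∞} (hr : 0 < r) :
    ∃ E' : Set ℝ, ∃ r' : ℝ≥0∞, Good E' ∧ 0 < r' ∧ r' ≤ r / 2 ∧ volume (symmDiff E E') ≤ r ∧
      ∃ ε : ℝ, 0 < ε ∧ ε < 1 / (n + 1) ∧ ∀ G, Good G → volume (symmDiff E' G) ≤ 2 * r' →
        ENNReal.ofReal |Real.log ε|⁻¹ * JJ ε (chi G) ≤ 3 * ENNReal.ofReal (1 / (n + 1)) := by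
  obtain ⟨ε, hε0, hε1, F, mF, hF1, hEF, hJ⟩ := dense_step hE.1 hE.2 hr n
  obtain ⟨C, hC, hst⟩ := JJ_stable ε hε0
  set A := ENNReal.ofReal |Real.log ε|⁻¹ with hA
  have hAf : A ≠ ∞ := by simp [hA]
  set δ := ENNReal.ofReal (1 / ((n:ℝ) + 1)) with hδ
  have hδ0 : 0 < δ := by rw [hδ, ENNReal.ofReal_pos]; positivity
  have hD : 4 * (A * C) + 1 ≠ ∞ := by finiteness
  set r' := min (r / 2) (min 1 (δ / (4 * (A * C) + 1))) with hr'
  have hr'0 : 0 < r' := by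
    refine lt_min (ENNReal.half_pos hr.ne') (lt_min one_pos (ENNReal.div_pos hδ0.ne' hD))
  have hr'1 : r' ≤ 1 := (min_le_right _ _).trans (min_le_left _ _)
  have hr'2 : r' ≤ δ / (4 * (A * C) + 1) := (min_le_right _ _).trans (min_le_right _ _)
  refine ⟨F, r', ⟨mF, hF1⟩, hr'0, min_le_left _ _, hEF, ε, hε0, hε1, ?_⟩
  intro G hG hv
  have h1 := hst F G mF hG.1 hF1 hG.2
  have h2 : A * C * (volume (symmDiff F G)) ^ 2 ≤ δ := by
    calc A * C * (volume (symmDiff F G)) ^ 2 ≤ A * C * (2 * r') ^ 2 := by gcongr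
      _ = 4 * (A * C) * (r' * r') := by ring
      _ ≤ (4 * (A * C) + 1) * (1 * r') := by
          gcongr
          exact le_self_add
      _ ≤ (4 * (A * C) + 1) * (δ / (4 * (A * C) + 1)) := by rw [one_mul]; gcongr
      _ ≤ δ := ENNReal.mul_div_le
  calc A * JJ ε (chi G) ≤ A * (2 * JJ ε (chi F) + C * (volume (symmDiff F G)) ^ 2) := by gcongr
    _ = 2 * (A * JJ ε (chi F)) + A * C * (volume (symmDiff F G)) ^ 2 := by ring
    _ ≤ 2 * δ + δ := by gcongr
    _ = 3 * δ := by ring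

/-- there is a measurable set `E ⊆ [0,1]` with `0 < |E| < 1` such that
`liminf_{ε→0⁺} (1/|log ε|) ‖γ_ε ∗ 1_E‖_{H^{1/2}}² = 0`. -/
theorem exists_subset_unitInterval_vanishing_liminf :
    ∃ E : Set ℝ, MeasurableSet E ∧ E ⊆ Set.Icc 0 1 ∧
      0 < volume E ∧ volume E < 1 ∧
      Filter.liminf
        (fun ε : ℝ => ENNReal.ofReal |Real.log ε|⁻¹ *
          H12e (conv (gaussSc ε) (E.indicator fun _ => (1 : ℝ))))
        (𝓝[>] (0 : ℝ)) = 0 := by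
  choose nE nr hgood hpos hhalf hdist heps using
    fun (n : ℕ) (p : {p : Set ℝ × ℝ≥0∞ // Good p.1 ∧ 0 < p.2}) => full_step n p.2.1 p.2.2
  have hinit : Good (Set.Icc (0:ℝ) (1/2)) ∧ (0:ℝ≥0∞) < ENNReal.ofReal (1/16) :=
    ⟨⟨measurableSet_Icc, Set.Icc_subset_Icc_right (by norm_num)⟩, by
      rw [ENNReal.ofReal_pos]; norm_num⟩
  let S : ℕ → {p : Set ℝ × ℝ≥0∞ // Good p.1 ∧ 0 < p.2} := fun n =>
    Nat.rec ⟨(Set.Icc (0:ℝ) (1/2), ENNReal.ofReal (1/16)), hinit⟩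
      (fun n p => ⟨(nE n p, nr n p), hgood n p, hpos n p⟩) n
  set E : ℕ → Set ℝ := fun n => (S n).1.1 with hE
  set r : ℕ → ℝ≥0∞ := fun n => (S n).1.2 with hr
  have hEg : ∀ n, Good (E n) := fun n => (S n).2.1
  have hrh : ∀ n, r (n + 1) ≤ r n / 2 := fun n => hhalf n (S n)
  have hED : ∀ n, volume (symmDiff (E n) (E (n + 1))) ≤ r n := fun n => hdist n (S n)
  have hrj : ∀ n j, r (n + j) ≤ r n * (2⁻¹ : ℝ≥0∞) ^ j := by
    intro n j
    induction j with
    | zero => simp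
    | succ j ih =>
      calc r (n + (j + 1)) ≤ r (n + j) / 2 := hrh (n + j)
        _ ≤ (r n * (2⁻¹ : ℝ≥0∞) ^ j) / 2 := by gcongr
        _ = _ := by rw [div_eq_mul_inv, pow_succ, mul_assoc]
  set L : Set ℝ := ⋂ N, ⋃ k, E (N + k) with hL
  have hLm : MeasurableSet L :=
    MeasurableSet.iInter fun N => MeasurableSet.iUnion fun k => (hEg (N + k)).1
  have hL1 : L ⊆ Set.Icc 0 1 := by
    intro x hx
    obtain ⟨k, hk⟩ := Set.mem_iUnion.1 (Set.mem_iInter.1 hx 0)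
    exact (hEg _).2 hk
  have hLg : Good L := ⟨hLm, hL1⟩
  have hLd : ∀ n, volume (symmDiff (E n) L) ≤ 2 * r n := by
    intro n
    have hsub : symmDiff (E n) L ⊆ ⋃ j, symmDiff (E (n + j)) (E (n + j + 1)) := by
      intro x hx
      by_contra hcon
      have hcon' : ∀ j, (x ∈ E (n + j) ↔ x ∈ E (n + j + 1)) := by
        intro j
        have : x ∉ symmDiff (E (n + j)) (E (n + j + 1)) :=
          fun h => hcon (Set.mem_iUnion.2 ⟨j, h⟩)
        rw [Set.mem_symmDiff] at this
        tauto
      have hall : ∀ j, (x ∈ E n ↔ x ∈ E (n + j)) := by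
        intro j
        induction j with
        | zero => simp
        | succ j ih => exact ih.trans (hcon' j)
      have hiff : x ∈ E n ↔ x ∈ L := by
        constructor
        · intro h
          refine Set.mem_iInter.2 fun N => Set.mem_iUnion.2 ⟨n, ?_⟩
          rw [add_comm]
          exact (hall N).1 h
        · intro h
          obtain ⟨k, hk⟩ := Set.mem_iUnion.1 (Set.mem_iInter.1 h n)
          exact (hall k).2 hk
      rw [Set.mem_symmDiff] at hx
      tauto
    calc volume (symmDiff (E n) L) ≤ ∑' j, volume (symmDiff (E (n + j)) (E (n + j + 1))) :=
          (measure_mono hsub).trans (measure_iUnion_le _)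
      _ ≤ ∑' j, r n * (2⁻¹ : ℝ≥0∞) ^ j := ENNReal.tsum_le_tsum fun j =>
          (hED (n + j)).trans (hrj n j)
      _ = 2 * r n := by
          rw [ENNReal.tsum_mul_left, ENNReal.tsum_geometric, ENNReal.one_sub_inv_two, inv_inv,
            mul_comm]
  have hd0 : volume (symmDiff (Set.Icc (0:ℝ) (1/2)) L) ≤ ENNReal.ofReal (1/8) := by
    refine (hLd 0).trans (le_of_eq ?_)
    change 2 * ENNReal.ofReal (1/16) = _
    have h2 : (2 : ℝ≥0∞) = ENNReal.ofReal 2 := by simp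
    rw [h2, ← ENNReal.ofReal_mul (by norm_num)]
    norm_num
  have hv0 : volume (Set.Icc (0:ℝ) (1/2)) = ENNReal.ofReal (1/2) := by
    rw [Real.volume_Icc, sub_zero]
  refine ⟨L, hLm, hL1, ?_, ?_, ?_⟩
  · rw [pos_iff_ne_zero]
    intro h0
    have h1 : Set.Icc (0:ℝ) (1/2) ⊆ L ∪ symmDiff (Set.Icc (0:ℝ) (1/2)) L := by
      intro x hx
      by_cases h : x ∈ L
      · exact Or.inl h
      · exact Or.inr (Or.inl ⟨hx, h⟩)
    have h2 := (measure_mono (μ := volume) h1).trans (measure_union_le _ _)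
    rw [h0, zero_add, hv0] at h2
    have h3 := h2.trans hd0
    rw [ENNReal.ofReal_le_ofReal_iff (by norm_num)] at h3
    norm_num at h3
  · have h1 : L ⊆ Set.Icc (0:ℝ) (1/2) ∪ symmDiff (Set.Icc (0:ℝ) (1/2)) L := by
      intro x hx
      by_cases h : x ∈ Set.Icc (0:ℝ) (1/2)
      · exact Or.inl h
      · exact Or.inr (Or.inr ⟨hx, h⟩)
    refine ((measure_mono (μ := volume) h1).trans (measure_union_le _ _)).trans_lt ?_
    rw [hv0]
    refine (add_le_add le_rfl hd0).trans_lt ?_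
    rw [← ENNReal.ofReal_add (by norm_num) (by norm_num), ENNReal.ofReal_lt_one]
    norm_num
  · rw [← nonpos_iff_eq_zero]
    refine le_of_forall_gt_imp_ge_of_dense fun c hc => ?_
    apply liminf_le_of_frequently_le'
    rw [frequently_iff]
    intro V hV
    obtain ⟨u, hu, huV⟩ := mem_nhdsGT_iff_exists_Ioo_subset.1 hV
    have hlim : Tendsto (fun n : ℕ => 3 * ENNReal.ofReal (1 / ((n:ℝ) + 1))) atTop (𝓝 0) := by
      have h1 := ENNReal.tendsto_ofReal (tendsto_one_div_add_atTop_nhds_zero_nat (𝕜 := ℝ))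
      rw [ENNReal.ofReal_zero] at h1
      simpa using ENNReal.Tendsto.const_mul (a := 3) h1 (Or.inr (by simp))
    have hlim2 := (tendsto_one_div_add_atTop_nhds_zero_nat (𝕜 := ℝ)).eventually
      (gt_mem_nhds (Set.mem_Ioi.1 hu))
    obtain ⟨n, hn1, hn2⟩ := ((hlim.eventually (gt_mem_nhds hc)).and hlim2).exists
    obtain ⟨ε, hε0, hε1, hε⟩ := heps n (S n)
    refine ⟨ε, huV ⟨hε0, hε1.trans hn2⟩, ?_⟩
    rw [H12e_eq ε hε0 hLm hL1]
    exact (hε L hLg (hLd (n + 1))).trans hn1.le
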